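/- (Integer Carathéodory property of Graver bases.) Let A be an integer m×N matrix with N ≥ 2 and let x ∈ ℤ^N satisfy Ax = 0. Then there exist an integer k with 0 ≤ k ≤ 2(N−1), elements g₁,…,g_k of the Graver basis 𝒢(A) with gᵢ ⊑ x for all i, and positive integers γ₁,…,γ_k such that x = Σ_{i=1}^k γᵢgᵢ. -/

import Mathlib

open Matrix

/-- The conformal (sign-compatible) partial order `x ⊑ y` on integer vectors:
`x k * y k ≥ 0` and `|x k| ≤ |y k|` for every coordinate `k`. -/
def ConformalLe {ν : Type*} (x y : ν → ℤ) : Prop :=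
  ∀ k, 0 ≤ x k * y k ∧ |x k| ≤ |y k|

/-- The Graver basis of an integer matrix `A`: the set of `⊑`-minimal elements of
`{x : A x = 0, x ≠ 0}`. -/
def GraverBasis {μ ν : Type*} [Fintype ν] (A : Matrix μ ν ℤ) : Set (ν → ℤ) :=
  {x | A.mulVec x = 0 ∧ x ≠ 0 ∧
    ∀ y, A.mulVec y = 0 → y ≠ 0 → ConformalLe y x → y = x}

/-- The `ι`-fold product of the bimatrix with blocks `A1` (first block, `r × τ`) and
`A2` (second block, `s × τ`): the first `r` rows are `(A1 A1 ⋯ A1)` and the remaining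
rows form a block-diagonal matrix with a copy of `A2` for each index in `ι`. -/
def nFold {r s : ℕ} {τ : Type*} (A1 : Matrix (Fin r) τ ℤ) (A2 : Matrix (Fin s) τ ℤ)
    (ι : Type*) [DecidableEq ι] : Matrix (Fin r ⊕ ι × Fin s) (ι × τ) ℤ :=
  Matrix.of fun i jt =>
    match i with
    | Sum.inl a => A1 a jt.2
    | Sum.inr (k, c) => if jt.1 = k then A2 c jt.2 else 0

/-- The `i`-th brick of a vector indexed by `ι × τ`. -/
def brick {ι τ : Type*} (x : ι × τ → ℤ) (i : ι) : τ → ℤ := fun j => x (i, j)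

/-- The Graver complexity of the bimatrix `(A1, A2)`: the largest number of nonzero
bricks appearing in any element of the Graver basis of any `n`-fold product. -/
noncomputable def graverComplexity {r s t : ℕ} (A1 : Matrix (Fin r) (Fin t) ℤ)
    (A2 : Matrix (Fin s) (Fin t) ℤ) : ℕ :=
  sSup {k : ℕ | ∃ (n : ℕ) (g : Fin n × Fin t → ℤ),
    g ∈ GraverBasis (nFold A1 A2 (Fin n)) ∧
    k = {i : Fin n | brick g i ≠ 0}.ncard}

/-- `Z(A)`: the set of all vectors in `ℤ^t` that are sums of at most `g(A)` elements
of the Graver basis of `A2`. -/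
noncomputable def ZSet {r s t : ℕ} (A1 : Matrix (Fin r) (Fin t) ℤ)
    (A2 : Matrix (Fin s) (Fin t) ℤ) : Set (Fin t → ℤ) :=
  {z | ∃ L : List (Fin t → ℤ), L.length ≤ graverComplexity A1 A2 ∧
    (∀ h ∈ L, h ∈ GraverBasis A2) ∧ z = L.sum}

/-- The sign vector of `x`, with value `1` where `x` vanishes. -/
def orthantSign {ν : Type*} (x : ν → ℤ) (k : ν) : ℤ := if 0 ≤ x k then 1 else -1

theorem conformalLe_iff {ν : Type*} {x y : ν → ℤ} :
    ConformalLe y x ↔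
      ∀ k, 0 ≤ orthantSign x k * y k ∧ orthantSign x k * y k ≤ orthantSign x k * x k := by
  refine forall_congr' fun k => ?_
  unfold orthantSign
  split_ifs with h
  · rw [abs_of_nonneg h, abs_le]
    constructor
    · rintro ⟨h1, h2, h3⟩
      refine ⟨?_, by linarith⟩
      by_contra! h4
      nlinarith
    · rintro ⟨h1, h2⟩
      exact ⟨mul_nonneg (by linarith) h, by linarith, by linarith⟩
  · push Not at h
    rw [abs_of_neg h, abs_le]
    constructor
    · rintro ⟨h1, h2, h3⟩
      refine ⟨?_, by linarith⟩
      by_contra! h4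
      nlinarith
    · rintro ⟨h1, h2⟩
      exact ⟨by nlinarith, by linarith, by linarith⟩

theorem ConformalLe.refl {ν : Type*} (x : ν → ℤ) : ConformalLe x x :=
  fun _ => ⟨mul_self_nonneg _, le_rfl⟩

theorem ConformalLe.sub {ν : Type*} {x y : ν → ℤ} (h : ConformalLe y x) :
    ConformalLe (x - y) x := by
  rw [conformalLe_iff] at h ⊢
  intro k
  have := h k
  simp only [Pi.sub_apply, mul_sub]
  exact ⟨by linarith, by linarith⟩

theorem ConformalLe.trans {ν : Type*} {x y z : ν → ℤ} (h : ConformalLe x y)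
    (h' : ConformalLe y z) : ConformalLe x z := by
  intro k
  refine ⟨?_, (h k).2.trans (h' k).2⟩
  rcases eq_or_ne (y k) 0 with h0 | h0
  · have h1 : x k = 0 := by simpa [h0] using (h k).2
    simp [h1]
  · have h1 := mul_nonneg (h k).1 (h' k).1
    have h2 : 0 < y k * y k := mul_self_pos.2 h0
    by_contra! h3
    nlinarith

theorem ConformalLe.sum_abs_eq {ν : Type*} [Fintype ν] {x y : ν → ℤ} (h : ConformalLe y x) :
    ∑ k, |x k| = ∑ k, |y k| + ∑ k, |(x - y) k| := by
  rw [← Finset.sum_add_distrib]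
  refine Finset.sum_congr rfl fun k _ => ?_
  have h1 := conformalLe_iff.1 h k
  unfold orthantSign at h1
  simp only [Pi.sub_apply]
  split_ifs at h1 with h0
  · rw [abs_of_nonneg h0, abs_of_nonneg (by linarith : 0 ≤ y k),
      abs_of_nonneg (by linarith : 0 ≤ x k - y k)]
    ring
  · rw [abs_of_nonpos (by linarith : x k ≤ 0), abs_of_nonpos (by linarith : y k ≤ 0),
      abs_of_nonpos (by linarith : x k - y k ≤ 0)]
    ring

theorem sum_abs_pos {ν : Type*} [Fintype ν] {x : ν → ℤ} (h : x ≠ 0) : 0 < ∑ k, |x k| := by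
  obtain ⟨k, hk⟩ := Function.ne_iff.1 h
  exact Finset.sum_pos' (fun _ _ => abs_nonneg _) ⟨k, Finset.mem_univ k, abs_pos.2 hk⟩

/-- Every integer kernel vector is a conformal sum of Graver basis elements. -/
theorem mem_span_graverBasis {μ ν : Type*} [Fintype ν] (A : Matrix μ ν ℤ) (x z : ν → ℤ)
    (hz : A.mulVec z = 0) (hzx : ConformalLe z x) :
    z ∈ Submodule.span ℕ {g | g ∈ GraverBasis A ∧ ConformalLe g x} := by
  induction hn : (∑ k, |z k|).toNat using Nat.strong_induction_on generalizing z with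
  | _ n ih =>
    rcases eq_or_ne z 0 with rfl | h0
    · exact zero_mem _
    by_cases hg : z ∈ GraverBasis A
    · exact Submodule.subset_span ⟨hg, hzx⟩
    · have : ∃ y, A.mulVec y = 0 ∧ y ≠ 0 ∧ ConformalLe y z ∧ y ≠ z := by
        by_contra! h
        exact hg ⟨hz, h0, h⟩
      obtain ⟨y, hy, hy0, hyz, hne⟩ := this
      have h1 := hyz.sum_abs_eq
      have h2 := sum_abs_pos hy0
      have h3 := sum_abs_pos (sub_ne_zero.2 hne.symm)
      have h4 := ih _ (by omega) y hy (hyz.trans hzx) rfl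
      have h5 := ih _ (by omega) (z - y) (by rw [Matrix.mulVec_sub, hz, hy, sub_zero])
        (hyz.sub.trans hzx) rfl
      simpa using add_mem h4 h5

theorem finite_conformalLe {ν : Type*} [Finite ν] (x : ν → ℤ) :
    {y | ConformalLe y x}.Finite := by
  refine (Set.Finite.pi' (t := fun k => Set.Icc (-|x k|) |x k|)
    fun _ => Set.finite_Icc _ _).subset fun y hy k => ?_
  exact abs_le.1 (hy k).2

/-- A bounded feasible linear program in standard form, maximizing the sum of the variables, has
an optimal basic solution. -/
theorem exists_optimal_basic_solution {ι κ : Type*} [Fintype ι] (v : ι → κ → ℝ) (b : κ → ℝ)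
    (B : ℝ) (hne : ∃ w : ι → ℝ, 0 ≤ w ∧ ∑ i, w i • v i = b)
    (hB : ∀ w : ι → ℝ, 0 ≤ w → ∑ i, w i • v i = b → ∑ i, w i ≤ B) :
    ∃ w : ι → ℝ, 0 ≤ w ∧ ∑ i, w i • v i = b ∧
      (∀ u : ι → ℝ, 0 ≤ u → ∑ i, u i • v i = b → ∑ i, u i ≤ ∑ i, w i) ∧
      LinearIndependent ℝ (fun i : {i // w i ≠ 0} => v i) := by
  classical
  set F : Set (ι → ℝ) := {w | 0 ≤ w ∧ ∑ i, w i • v i = b} with hF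
  have hcomp : IsCompact F := by
    refine (isCompact_Icc (a := (0 : ι → ℝ)) (b := fun _ => B)).of_isClosed_subset ?_ ?_
    · exact isClosed_Ici.inter (isClosed_eq (by fun_prop) continuous_const)
    · rintro w ⟨h0, h1⟩
      exact ⟨h0, fun i => (Finset.single_le_sum (fun j _ => h0 j) (Finset.mem_univ i)).trans
        (hB w h0 h1)⟩
  obtain ⟨w₀, hw₀, hmax₀⟩ := hcomp.exists_isMaxOn hne
    (f := fun w : ι → ℝ => ∑ i, w i) (by fun_prop)
  let O : Set (ι → ℝ) := {w | w ∈ F ∧ ∀ u ∈ F, ∑ i, u i ≤ ∑ i, w i}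
  obtain ⟨w, ⟨hwF, hwmax⟩, hwmin⟩ := exists_minimalFor_of_wellFoundedLT (· ∈ O)
    (fun w : ι → ℝ => (Finset.univ.filter fun i => w i ≠ 0)) ⟨w₀, hw₀, hmax₀⟩
  refine ⟨w, hwF.1, hwF.2, fun u h0 h1 => hwmax u ⟨h0, h1⟩, ?_⟩
  have key : ∀ c : ι → ℝ, (∀ i, w i = 0 → c i = 0) → ∑ i, c i • v i = 0 → ∑ i, c i ≤ 0 →
      c = 0 := by
    intro c hcw hc hsum
    have hsub (t : ℝ) : ∑ i, (w - t • c) i • v i = b := by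
      simp only [Pi.sub_apply, Pi.smul_apply, sub_smul, Finset.sum_sub_distrib, smul_eq_mul,
        mul_smul, ← Finset.smul_sum, hc, hwF.2, smul_zero, sub_zero]
    have hobj (t : ℝ) : ∑ i, (w - t • c) i = ∑ i, w i - t * ∑ i, c i := by
      simp [Finset.mul_sum]
    by_cases hpos : ∃ i, 0 < c i
    · exfalso
      obtain ⟨i, hi, hmin⟩ := Finset.exists_min_image (Finset.univ.filter fun i => 0 < c i)
        (fun i => w i / c i) (by simpa [Finset.filter_nonempty_iff] using hpos)
      simp only [Finset.mem_filter, Finset.mem_univ, true_and] at hi hmin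
      have ht : 0 ≤ w i / c i := div_nonneg (hwF.1 i) hi.le
      have hF' : w - (w i / c i) • c ∈ F := by
        refine ⟨fun j => ?_, hsub _⟩
        simp only [Pi.zero_apply, Pi.sub_apply, Pi.smul_apply, smul_eq_mul, sub_nonneg]
        rcases lt_or_ge 0 (c j) with hj | hj
        · exact (le_div_iff₀ hj).1 (hmin j hj)
        · exact (mul_nonpos_of_nonneg_of_nonpos ht hj).trans (hwF.1 j)
      have hO : w - (w i / c i) • c ∈ O := by
        refine ⟨hF', fun u hu => (hwmax u hu).trans ?_⟩
        rw [hobj]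
        nlinarith
      have hle := hwmin hO (fun j hj => by
        simp only [Finset.mem_filter, Finset.mem_univ, true_and] at hj ⊢
        contrapose! hj
        simp [hj, hcw j hj])
      have hmem : i ∈ Finset.univ.filter fun j => w j ≠ 0 := by
        simp only [Finset.mem_filter, Finset.mem_univ, true_and]
        exact fun h => hi.ne' (hcw i h)
      have := hle hmem
      simp [hi.ne'] at this
    · push Not at hpos
      have h1 : w - (1 : ℝ) • c ∈ F := by
        refine ⟨fun j => ?_, hsub _⟩
        have := hwF.1 j
        have := hpos j
        simp only [Pi.zero_apply, Pi.sub_apply, Pi.smul_apply, one_smul] at *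
        linarith
      have h2 := hwmax _ h1
      rw [hobj] at h2
      have h3 : ∑ i, c i = 0 := by linarith
      rw [Finset.sum_eq_zero_iff_of_nonpos fun i _ => hpos i] at h3
      exact funext fun i => h3 i (Finset.mem_univ i)
  have key' : ∀ c : ι → ℝ, (∀ i, w i = 0 → c i = 0) → ∑ i, c i • v i = 0 → c = 0 := by
    intro c hcw hc
    rcases le_total (∑ i, c i) 0 with h | h
    · exact key c hcw hc h
    · exact neg_eq_zero.1 <| key (-c) (fun i hi => by simp [hcw i hi]) (by simp [hc])
        (by simpa using h)
  rw [Fintype.linearIndependent_iff]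
  intro c hc i
  have := key' (fun i => if h : w i ≠ 0 then c ⟨i, h⟩ else 0) (fun i hi => by simp [hi]) (by
    rw [← hc, ← Fintype.sum_subtype_add_sum_subtype (fun i => w i ≠ 0)]
    exact (congrArg₂ (· + ·) (Finset.sum_congr rfl fun j _ => by rw [dif_pos j.2])
      (Finset.sum_eq_zero fun j _ => by rw [dif_neg j.2, zero_smul])).trans (add_zero _))
  simpa [i.2] using congrFun this i

/-- Reindexing a nonnegative integer combination by the support of its coefficients. -/
theorem exists_fin_sum_of_support {ι M : Type*} [Fintype ι] [AddCommGroup M] (p : M → Prop)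
    (v : ι → M) (c : ι → ℕ) (hp : ∀ i, c i ≠ 0 → p (v i)) :
    ∃ (g : Fin (Finset.univ.filter fun i => c i ≠ 0).card → M)
      (γ : Fin (Finset.univ.filter fun i => c i ≠ 0).card → ℕ),
      (∀ i, p (g i)) ∧ (∀ i, 0 < γ i) ∧ ∑ i, c i • v i = ∑ i, (γ i : ℤ) • g i := by
  classical
  let e := (Finset.univ.filter fun i : ι => c i ≠ 0).equivFin.symm
  have he (i) : c (e i) ≠ 0 := (Finset.mem_filter.1 (e i).2).2
  refine ⟨fun i => v (e i), fun i => c (e i), fun i => hp _ (he i),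
    fun i => Nat.pos_of_ne_zero (he i), ?_⟩
  simp only [natCast_zsmul]
  rw [e.sum_comp (fun i => c i • v i), Finset.sum_coe_sort _ (fun i => c i • v i)]
  refine (Finset.sum_filter_of_ne (p := fun i => c i ≠ 0) fun i _ h h0 => h ?_).symm
  rw [h0, zero_smul]

theorem single_mem_graverBasis_zero {μ ν : Type*} [Fintype ν] [DecidableEq ν] (k : ν) {a : ℤ}
    (ha : |a| = 1) : Pi.single k a ∈ GraverBasis (0 : Matrix μ ν ℤ) := by
  refine ⟨Matrix.zero_mulVec _, ?_, ?_⟩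
  · rw [Ne, Pi.single_eq_zero_iff]
    rintro rfl
    simp at ha
  · intro y _ hy0 hy
    have hj (j) (h : j ≠ k) : y j = 0 := by simpa [h] using (hy j).2
    have hk : y k ≠ 0 := by
      intro h
      exact hy0 (funext fun j => by rcases eq_or_ne j k with rfl | h' <;> simp_all)
    have hk' : y k = a := by
      have h1 := hy k
      rw [Pi.single_eq_same, ha, abs_le] at h1
      rcases eq_or_eq_neg_of_abs_eq ha with rfl | rfl <;> omega
    funext j
    rcases eq_or_ne j k with rfl | h
    · simpa using hk'
    · simp [h, hj j h]

theorem exists_short_combination_zero {μ : Type*} {N : ℕ} (x : Fin N → ℤ) :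
    ∃ (v : Fin N → (Fin N → ℤ)) (c : Fin N → ℕ),
      (∀ i, c i ≠ 0 → v i ∈ GraverBasis (0 : Matrix μ (Fin N) ℤ) ∧ ConformalLe (v i) x) ∧
      ∑ i, c i • v i = x := by
  refine ⟨fun i => Pi.single i (x i).sign, fun i => (x i).natAbs, fun i hi => ⟨?_, fun k => ?_⟩, ?_⟩
  · apply single_mem_graverBasis_zero
    have h0 : x i ≠ 0 := by simpa using hi
    rcases lt_or_gt_of_ne h0 with h | h
    · simp [Int.sign_eq_neg_one_of_neg h]
    · simp [Int.sign_eq_one_of_pos h]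
  · have h0 : x i ≠ 0 := by simpa using hi
    rcases eq_or_ne k i with rfl | h
    · rcases lt_or_gt_of_ne h0 with h | h
      · simp only [Pi.single_eq_same, Int.sign_eq_neg_one_of_neg h, abs_of_neg h]
        simp
        omega
      · simp only [Pi.single_eq_same, Int.sign_eq_one_of_pos h, abs_of_pos h]
        simp
        omega
    · simp [h]
  · funext k
    rw [Finset.sum_apply, Finset.sum_eq_single k]
    · simp [mul_comm |x k|, Int.sign_mul_abs]
    · intro j _ hj
      simp [hj.symm]
    · simp

/-- A linearly independent family of kernel vectors of a nonzero matrix has fewer members than the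
matrix has columns. -/
theorem card_lt_of_linearIndependent_of_mulVec_eq_zero {μ ν ι : Type*} [Fintype ν] [Fintype ι]
    {A : Matrix μ ν ℤ} (hA : A ≠ 0) (v : ι → ν → ℤ) (hv : ∀ i, A.mulVec (v i) = 0)
    (h : LinearIndependent ℝ (fun i k => (v i k : ℝ))) : Fintype.card ι < Fintype.card ν := by
  classical
  have hle := h.fintype_card_le_finrank
  rw [Module.finrank_fintype_fun_eq_card] at hle
  refine lt_of_le_of_ne hle fun heq => hA ?_
  have hspan := h.span_eq_top_of_card_eq_finrank'
    (heq.trans (Module.finrank_fintype_fun_eq_card ℝ).symm)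
  have h0 : (A.map (Int.cast : ℤ → ℝ)).mulVecLin = 0 := by
    refine LinearMap.ext_on_range hspan fun i => ?_
    funext r
    have := congrFun (hv i) r
    simp only [Matrix.mulVec, dotProduct, Pi.zero_apply] at this
    simp only [Matrix.mulVecLin_apply, Matrix.mulVec, dotProduct, Matrix.map_apply,
      LinearMap.zero_apply, Pi.zero_apply]
    exact_mod_cast this
  ext r k
  have := congrFun (LinearMap.congr_fun h0 (Pi.single k 1)) r
  simpa using this

theorem exists_short_combination {μ : Type*} {N : ℕ} {A : Matrix μ (Fin N) ℤ} (hA : A ≠ 0)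
    (x : Fin N → ℤ) (hx : A.mulVec x = 0) :
    ∃ (ι : Type) (_ : Fintype ι) (v : ι → (Fin N → ℤ)) (c : ι → ℕ),
      (Finset.univ.filter fun i => c i ≠ 0).card ≤ 2 * (N - 1) ∧
      (∀ i, v i ∈ GraverBasis A ∧ ConformalLe (v i) x) ∧ ∑ i, c i • v i = x := by
  classical
  set G := {g | g ∈ GraverBasis A ∧ ConformalLe g x} with hG
  have : Fintype G := ((finite_conformalLe x).subset fun g hg => hg.2).fintype
  have hspan (z : Fin N → ℤ) (hz : A.mulVec z = 0) (hzx : ConformalLe z x) :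
      ∃ n : G → ℕ, ∑ i, n i • i.1 = z := by
    have h := mem_span_graverBasis A x z hz hzx
    rw [← hG, ← Subtype.range_coe (s := G), Submodule.mem_span_range_iff_exists_fun] at h
    exact h
  have hcast (n : G → ℕ) {z : Fin N → ℤ} (h : ∑ i, n i • i.1 = z) :
      ∑ i, (n i : ℝ) • (fun k => (i.1 k : ℝ)) = fun k => (z k : ℝ) := by
    subst h
    funext k
    simp
  have hs (i : G) (k : Fin N) := (conformalLe_iff.1 i.2.2 k).1
  have hsign (w : G → ℝ) (hw : ∑ i, w i • (fun k => (i.1 k : ℝ)) = fun k => (x k : ℝ)) (k) :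
      ∑ i, w i * ((orthantSign x k * i.1 k : ℤ) : ℝ) = ((orthantSign x k * x k : ℤ) : ℝ) := by
    have := congrFun hw k
    simp only [Finset.sum_apply, Pi.smul_apply, smul_eq_mul] at this
    push_cast
    rw [← this, Finset.mul_sum]
    exact Finset.sum_congr rfl fun i _ => by ring
  obtain ⟨n₀, hn₀⟩ := hspan x hx (.refl x)
  obtain ⟨w, hw0, hw, hmax, hli⟩ := exists_optimal_basic_solution
    (fun (i : G) k => (i.1 k : ℝ)) (fun k => (x k : ℝ)) (∑ k, ((orthantSign x k * x k : ℤ) : ℝ))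
    ⟨fun i => n₀ i, fun i => Nat.cast_nonneg _, hcast n₀ hn₀⟩ (by
      intro w hw0 hw
      simp only [← hsign w hw]
      rw [Finset.sum_comm]
      refine Finset.sum_le_sum fun i _ => ?_
      rw [← Finset.mul_sum]
      refine le_mul_of_one_le_right (hw0 i) ?_
      rw [← Int.cast_sum]
      obtain ⟨k, hk⟩ := Function.ne_iff.1 i.2.1.2.1
      have hk' : orthantSign x k * i.1 k ≠ 0 := by
        refine mul_ne_zero ?_ hk
        unfold orthantSign
        split_ifs <;> simp
      exact_mod_cast Finset.sum_pos' (fun k _ => hs i k)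
        ⟨k, Finset.mem_univ k, lt_of_le_of_ne (hs i k) hk'.symm⟩)
  set z : Fin N → ℤ := x - ∑ i : G, ⌊w i⌋₊ • i.1 with hz
  have hzA : A.mulVec z = 0 := by
    have : A.mulVec (∑ i : G, ⌊w i⌋₊ • i.1) = 0 := by
      rw [Matrix.mulVec_sum]
      exact Finset.sum_eq_zero fun i _ => by rw [Matrix.mulVec_smul, i.2.1.1, smul_zero]
    rw [hz, Matrix.mulVec_sub, hx, this, sub_zero]
  have hzx : ConformalLe z x := by
    apply ConformalLe.sub
    rw [conformalLe_iff]
    intro k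
    simp only [Finset.sum_apply, Pi.smul_apply, Finset.mul_sum, mul_smul_comm]
    refine ⟨Finset.sum_nonneg fun i _ => nsmul_nonneg (hs i k) _, ?_⟩
    rw [← Int.cast_le (R := ℝ), ← hsign w hw k, Int.cast_sum]
    refine Finset.sum_le_sum fun i _ => ?_
    rw [nsmul_eq_mul, Int.cast_mul, Int.cast_natCast]
    exact mul_le_mul_of_nonneg_right (Nat.floor_le (hw0 i)) (Int.cast_nonneg (hs i k))
  obtain ⟨n, hn⟩ := hspan z hzA hzx
  have hsum : ∑ i : G, (⌊w i⌋₊ + n i) • i.1 = x := by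
    simp only [add_smul, Finset.sum_add_distrib, hn, hz]
    abel
  have hopt := hmax (fun i => ((⌊w i⌋₊ + n i : ℕ) : ℝ)) (fun i => Nat.cast_nonneg _)
    (hcast _ hsum)
  set S := Finset.univ.filter fun i => w i ≠ 0 with hS
  have hScard : S.card < N := by
    have := card_lt_of_linearIndependent_of_mulVec_eq_zero hA
      (fun i : {i // w i ≠ 0} => i.1.1) (fun i => i.1.2.1.1) hli
    rwa [Fintype.card_fin, Fintype.card_subtype] at this
  have hn_sum : ∑ i, (n i : ℝ) ≤ ∑ i ∈ S, (w i - ⌊w i⌋₊) := by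
    push_cast at hopt
    rw [Finset.sum_add_distrib] at hopt
    have : ∑ i ∈ S, (w i - ⌊w i⌋₊) = ∑ i, (w i - ⌊w i⌋₊) :=
      Finset.sum_filter_of_ne fun i _ h h0 => h (by simp [h0])
    rw [this, Finset.sum_sub_distrib]
    linarith
  have hn_lt : ∑ i, n i ≤ S.card - 1 := by
    rcases S.eq_empty_or_nonempty with h | h
    · rw [h] at hn_sum ⊢
      simp only [Finset.sum_empty] at hn_sum
      exact_mod_cast hn_sum
    · have h1 : ∑ i ∈ S, (w i - ⌊w i⌋₊) < ∑ i ∈ S, (1 : ℝ) :=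
        Finset.sum_lt_sum_of_nonempty h fun i _ => by linarith [Nat.lt_floor_add_one (w i)]
      have h2 : ∑ i, n i < S.card := by
        have := hn_sum.trans_lt h1
        simp only [Finset.sum_const, nsmul_eq_mul, mul_one] at this
        exact_mod_cast this
      omega
  have hn_card : (Finset.univ.filter fun i => n i ≠ 0).card ≤ ∑ i, n i := by
    rw [Finset.card_filter]
    refine Finset.sum_le_sum fun i _ => ?_
    split_ifs <;> omega
  refine ⟨G, inferInstance, fun i => i.1, fun i => ⌊w i⌋₊ + n i, ?_, fun i => i.2, hsum⟩
  have hsub : (Finset.univ.filter fun i : G => ⌊w i⌋₊ + n i ≠ 0) ⊆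
      S ∪ Finset.univ.filter fun i => n i ≠ 0 := by
    intro i hi
    simp only [hS, Finset.mem_union, Finset.mem_filter, Finset.mem_univ, true_and] at hi ⊢
    by_contra! h
    simp [h.1, h.2] at hi
  have := (Finset.card_le_card hsub).trans (Finset.card_union_le _ _)
  dsimp only
  omega

/-- **integer Carathéodory property of Graver bases.** If `N ≥ 2` and
`x ∈ ℤ^N` satisfies `A x = 0`, then `x` is a nonnegative integer combination
`x = ∑_{i=1}^k γᵢ gᵢ` of `k ≤ 2(N−1)` Graver basis elements `gᵢ ⊑ x` with positive
integer coefficients `γᵢ`. -/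
theorem integer_caratheodory_graver {m N : ℕ} (hN : 2 ≤ N)
    (A : Matrix (Fin m) (Fin N) ℤ) (x : Fin N → ℤ) (hx : A.mulVec x = 0) :
    ∃ (k : ℕ), k ≤ 2 * (N - 1) ∧
      ∃ (g : Fin k → (Fin N → ℤ)) (γ : Fin k → ℕ),
        (∀ i, g i ∈ GraverBasis A) ∧ (∀ i, ConformalLe (g i) x) ∧
        (∀ i, 0 < γ i) ∧ x = ∑ i, (γ i : ℤ) • g i := by
  obtain ⟨k, hk, g, γ, hg, hγ, h⟩ :
      ∃ k ≤ 2 * (N - 1), ∃ (g : Fin k → (Fin N → ℤ)) (γ : Fin k → ℕ),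
        (∀ i, g i ∈ GraverBasis A ∧ ConformalLe (g i) x) ∧ (∀ i, 0 < γ i) ∧
        x = ∑ i, (γ i : ℤ) • g i := by
    rcases eq_or_ne A 0 with rfl | hA
    · obtain ⟨v, c, hc, h⟩ := exists_short_combination_zero (μ := Fin m) x
      obtain ⟨g, γ, hg, hγ, h'⟩ := exists_fin_sum_of_support
        (fun g => g ∈ GraverBasis 0 ∧ ConformalLe g x) v c hc
      refine ⟨_, ?_, g, γ, hg, hγ, h.symm.trans h'⟩
      have := Finset.card_le_univ (Finset.univ.filter fun i => c i ≠ 0)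
      rw [Fintype.card_fin] at this
      omega
    · obtain ⟨ι, _, v, c, hcard, hv, h⟩ := exists_short_combination hA x hx
      obtain ⟨g, γ, hg, hγ, h'⟩ := exists_fin_sum_of_support
        (fun g => g ∈ GraverBasis A ∧ ConformalLe g x) v c fun i _ => hv i
      exact ⟨_, hcard, g, γ, hg, hγ, h.symm.trans h'⟩
  exact ⟨k, hk, g, γ, fun i => (hg i).1, fun i => (hg i).2, hγ, h⟩
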